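/- Let A_1, …, A_n (n ≥ 1) be real symmetric positive-semidefinite m×m matrices, and assume that some real linear combination of A_1, …, A_n has rank m. Define P(x_1, …, x_n) = det(Σ_{i=1}^n x_i A_i). Then P is strictly positive on (0,∞)^n, and P^{-β} is completely monotone on (0,∞)^n for every β in the set {0, 1/2, 1, 3/2, …} and for every real β ≥ (m−1)/2. -/

import Mathlib

/-- The open positive orthant `(0,∞)^ι`. -/
def posOrthant (ι : Type*) : Set (ι → ℝ) := {x | ∀ i, 0 < x i}

/-- A function `f : (0,∞)^ι → ℝ` is completely monotone if it is `C^∞` on the open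
orthant and `(−1)^k ∂^k f/(∂x_{i_1}···∂x_{i_k}) ≥ 0` there, for every `k ≥ 0` and all
indices `i_1, …, i_k`. -/
def CompletelyMonotoneOnOrthant {ι : Type*} [Fintype ι] [DecidableEq ι]
    (f : (ι → ℝ) → ℝ) : Prop :=
  ContDiffOn ℝ (⊤ : ℕ∞) f (posOrthant ι) ∧
    ∀ (k : ℕ) (idx : Fin k → ι), ∀ x ∈ posOrthant ι,
      0 ≤ (-1 : ℝ) ^ k *
        iteratedFDerivWithin ℝ k f (posOrthant ι) x (fun j => Pi.single (idx j) (1 : ℝ))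

open MeasureTheory
open scoped NNReal ENNReal

lemma isOpen_posOrthant (ι : Type*) [Finite ι] : IsOpen (posOrthant ι) := by
  simpa [posOrthant, Set.ofPred_forall] using
    isOpen_iInter_of_finite fun i : ι => isOpen_lt continuous_const (continuous_apply i)

/-- `f` agrees on the open orthant with the (everywhere finite) Laplace transform of a positive
measure supported on the closed orthant. -/
def IsLaplaceOnOrthant {ι : Type*} [Fintype ι] (f : (ι → ℝ) → ℝ) : Prop :=
  ∃ μ : Measure (ι → ℝ≥0), SFinite μ ∧ ∀ x ∈ posOrthant ι, 0 ≤ f x ∧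
    ∫⁻ y, ENNReal.ofReal (Real.exp (-∑ i, x i * y i)) ∂μ = ENNReal.ofReal (f x)

namespace IsLaplaceOnOrthant

variable {ι : Type*} [Fintype ι] {f g : (ι → ℝ) → ℝ}

lemma of_lintegral {Ω : Type*} [MeasurableSpace Ω] (P : Measure Ω) [SFinite P]
    (φ : Ω → ι → ℝ) (hφ : Measurable φ) (hφ0 : ∀ ω i, 0 ≤ φ ω i) (c : ℝ≥0∞) (hc0 : c ≠ 0)
    (hc : c ≠ ∞)
    (hf : ∀ x ∈ posOrthant ι, 0 ≤ f x ∧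
      ∫⁻ ω, ENNReal.ofReal (Real.exp (-∑ i, x i * φ ω i)) ∂P = c * ENNReal.ofReal (f x)) :
    IsLaplaceOnOrthant f := by
  have hm : Measurable fun ω i => (φ ω i).toNNReal := by fun_prop
  refine ⟨c⁻¹ • P.map fun ω i => (φ ω i).toNNReal, inferInstance, fun x hx => ⟨(hf x hx).1, ?_⟩⟩
  rw [lintegral_smul_measure, lintegral_map (by fun_prop) hm]
  simp only [Real.coe_toNNReal _ (hφ0 _ _)]
  rw [(hf x hx).2, smul_eq_mul, ← mul_assoc, ENNReal.inv_mul_cancel hc0 hc, one_mul]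

lemma congr (hf : IsLaplaceOnOrthant f) (h : ∀ x ∈ posOrthant ι, f x = g x) :
    IsLaplaceOnOrthant g := by
  obtain ⟨μ, hμ, H⟩ := hf
  exact ⟨μ, hμ, fun x hx => h x hx ▸ H x hx⟩

lemma one : IsLaplaceOnOrthant (fun _ : ι → ℝ => 1) :=
  ⟨Measure.dirac 0, inferInstance, fun x _ => ⟨zero_le_one, by
    rw [lintegral_dirac' _ (by fun_prop)]; simp⟩⟩

lemma mul (hf : IsLaplaceOnOrthant f) (hg : IsLaplaceOnOrthant g) :
    IsLaplaceOnOrthant (fun x => f x * g x) := by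
  obtain ⟨μ, hμ, Hf⟩ := hf
  obtain ⟨ν, hν, Hg⟩ := hg
  refine of_lintegral (μ.prod ν) (fun p i => p.1 i + p.2 i) (by fun_prop)
    (fun p i => by positivity) 1 (by simp) (by simp) fun x hx =>
    ⟨mul_nonneg (Hf x hx).1 (Hg x hx).1, ?_⟩
  rw [one_mul, ENNReal.ofReal_mul (Hf x hx).1, ← (Hf x hx).2, ← (Hg x hx).2,
    ← lintegral_prod_mul (Measurable.aemeasurable (by fun_prop))
      (Measurable.aemeasurable (by fun_prop))]
  congr! 2 with p
  rw [← ENNReal.ofReal_mul (Real.exp_nonneg _), ← Real.exp_add, ← neg_add,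
    ← Finset.sum_add_distrib]
  simp only [mul_add]

lemma pow (hf : IsLaplaceOnOrthant f) (k : ℕ) : IsLaplaceOnOrthant (fun x => f x ^ k) := by
  induction k with
  | zero => simpa using one
  | succ k ih => simpa only [pow_succ] using ih.mul hf

lemma integrable_exp {μ : Measure (ι → ℝ≥0)}
    {x : ι → ℝ} {c : ℝ}
    (h : ∫⁻ y, ENNReal.ofReal (Real.exp (-∑ i, x i * y i)) ∂μ = ENNReal.ofReal c) :
    Integrable (fun y : ι → ℝ≥0 => Real.exp (-∑ i, x i * y i)) μ := by
  refine ⟨Measurable.aestronglyMeasurable (by fun_prop), ?_⟩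
  rw [hasFiniteIntegral_iff_ofReal (.of_forall fun y => Real.exp_nonneg _), h]
  exact ENNReal.ofReal_lt_top

lemma mul_exp_neg_le {a : ℝ} (ha : 0 < a) {t s : ℝ} (hst : a * t ≤ s) :
    t * Real.exp (-(2 * s)) ≤ a⁻¹ * Real.exp (-s) := by
  have h1 : a * t ≤ Real.exp s := hst.trans (by linarith [Real.add_one_le_exp s])
  have h2 : Real.exp (-(2 * s)) = Real.exp (-s) * Real.exp (-s) := by
    rw [← Real.exp_add]; ring_nf
  have h3 : Real.exp s * Real.exp (-s) = 1 := by rw [← Real.exp_add]; simp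
  have h4 : t ≤ a⁻¹ * Real.exp s := by rwa [le_inv_mul_iff₀ ha]
  calc t * Real.exp (-(2 * s)) ≤ a⁻¹ * Real.exp s * Real.exp (-(2 * s)) := by gcongr
    _ = a⁻¹ * Real.exp (-s) * (Real.exp s * Real.exp (-s)) := by rw [h2]; ring
    _ = _ := by rw [h3, mul_one]

lemma exists_hasFDerivAt (hf : IsLaplaceOnOrthant f) :
    ∃ g : ι → (ι → ℝ) → ℝ, (∀ i, IsLaplaceOnOrthant (g i)) ∧ ∀ x ∈ posOrthant ι,
      HasFDerivAt f (∑ i, (-g i x) • ContinuousLinearMap.proj (R := ℝ) (φ := fun _ : ι => ℝ) i) x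
    := by
  obtain ⟨μ, hμ, Hf⟩ := hf
  have hint : ∀ x ∈ posOrthant ι,
      Integrable (fun y : ι → ℝ≥0 => Real.exp (-∑ i, x i * y i)) μ :=
    fun x hx => integrable_exp (Hf x hx).2
  have hhalf : ∀ (c : ℝ), 0 < c → ∀ x ∈ posOrthant ι, c • x ∈ posOrthant ι :=
    fun c hc x hx i => mul_pos hc (hx i)
  have hbound : ∀ x ∈ posOrthant ι, ∀ (i : ι) (y : ι → ℝ≥0),
      y i * Real.exp (-∑ j, x j * y j) ≤
        (x i / 2)⁻¹ * Real.exp (-∑ j, ((1 / 2 : ℝ) • x) j * y j) := by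
    intro x hx i y
    have h0 : ∀ j, 0 ≤ ((1 / 2 : ℝ) • x) j * y j := fun j =>
      mul_nonneg (hhalf _ (by norm_num) x hx j).le (y j).2
    have := mul_exp_neg_le (half_pos (hx i)) (t := y i) (s := ∑ j, ((1 / 2 : ℝ) • x) j * y j) (by
        refine le_trans (le_of_eq ?_) (Finset.single_le_sum (fun j _ => h0 j) (Finset.mem_univ i))
        simp only [Pi.smul_apply, smul_eq_mul]; ring)
    convert this using 3
    rw [Finset.mul_sum]; simp only [Pi.smul_apply, smul_eq_mul]
    ring_nf
  have hint' : ∀ x ∈ posOrthant ι, ∀ i,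
      Integrable (fun y : ι → ℝ≥0 => y i * Real.exp (-∑ j, x j * y j)) μ := by
    intro x hx i
    refine ((hint _ (hhalf (1 / 2) (by norm_num) x hx)).const_mul (x i / 2)⁻¹).mono'
      (Measurable.aestronglyMeasurable (by fun_prop)) (.of_forall fun y => ?_)
    rw [Real.norm_of_nonneg (by positivity)]
    exact hbound x hx i y
  refine ⟨fun i x => ∫ y, y i * Real.exp (-∑ j, x j * y j) ∂μ, fun i =>
    ⟨μ.withDensity fun y => y i, inferInstance, fun x hx =>
      ⟨integral_nonneg fun y => by positivity, ?_⟩⟩, fun x hx => ?_⟩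
  · rw [lintegral_withDensity_eq_lintegral_mul _ (by fun_prop) (by fun_prop),
      ofReal_integral_eq_lintegral_ofReal (hint' x hx i) (.of_forall fun y => by positivity)]
    congr! 2 with y
    rw [Pi.mul_apply, ENNReal.ofReal_mul (by positivity), ENNReal.ofReal_coe_nnreal]
  · have hfeq : ∀ z ∈ posOrthant ι, f z = ∫ y, Real.exp (-∑ i, z i * y i) ∂μ := by
      intro z hz
      rw [integral_eq_lintegral_of_nonneg_ae (.of_forall fun y => Real.exp_nonneg _)
        (Measurable.aestronglyMeasurable (by fun_prop)), (Hf z hz).2, ENNReal.toReal_ofReal (Hf z hz).1]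
    have hopen := isOpen_posOrthant ι
    let F' : (ι → ℝ) → (ι → ℝ≥0) → (ι → ℝ) →L[ℝ] ℝ := fun z y =>
      ∑ i, (-(y i * Real.exp (-∑ j, z j * y j))) •
        ContinuousLinearMap.proj (R := ℝ) (φ := fun _ : ι => ℝ) i
    let s : Set (ι → ℝ) := {z | ∀ i, x i / 2 < z i}
    have hs : s ∈ nhds x := by
      refine IsOpen.mem_nhds ?_ fun i => half_lt_self (hx i)
      simpa [s, Set.ofPred_forall] using
        isOpen_iInter_of_finite fun i : ι => isOpen_lt continuous_const (continuous_apply i)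
    have hx2 := hhalf (1 / 2) (by norm_num) x hx
    have key := hasFDerivAt_integral_of_dominated_of_fderiv_le (μ := μ) (x₀ := x) (s := s)
      (F := fun z (y : ι → ℝ≥0) => Real.exp (-∑ i, z i * (y i : ℝ))) (F' := F')
      (bound := fun y : ι → ℝ≥0 => ∑ i, y i * Real.exp (-∑ j, ((1 / 2 : ℝ) • x) j * y j))
      hs (.of_forall fun z => Measurable.aestronglyMeasurable (by fun_prop)) (hint x hx)
      (Finset.aestronglyMeasurable_fun_sum _ fun i _ => (hint' x hx i).1.neg.smul_const _) ?_
      (integrable_finsetSum _ fun i _ => hint' _ hx2 i) ?_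
    · have hF' : ∫ y, F' x y ∂μ = ∑ i, (-∫ y, y i * Real.exp (-∑ j, x j * y j) ∂μ) •
          ContinuousLinearMap.proj (R := ℝ) (φ := fun _ : ι => ℝ) i := by
        simp only [F']
        rw [integral_finsetSum]
        · simp_rw [integral_smul_const, integral_neg]
        · exact fun i _ => (hint' x hx i).neg.smul_const _
      rw [← hF']
      exact key.congr_of_eventuallyEq
        (Filter.eventually_of_mem (hopen.mem_nhds hx) fun z hz => hfeq z hz)
    · refine .of_forall fun y z hz => ?_
      refine (norm_sum_le _ _).trans (Finset.sum_le_sum fun i _ => ?_)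
      rw [norm_smul, norm_neg, Real.norm_of_nonneg (by positivity)]
      have hp : ‖ContinuousLinearMap.proj (R := ℝ) (φ := fun _ : ι => ℝ) i‖ ≤ 1 :=
        ContinuousLinearMap.opNorm_le_bound _ zero_le_one fun v => by
          simpa using norm_le_pi_norm v i
      refine (mul_le_of_le_one_right (by positivity) hp).trans ?_
      gcongr with j
      have := hz j
      simp only [Pi.smul_apply, smul_eq_mul]
      linarith
    · refine .of_forall fun y z hz => ?_
      have h1 : HasFDerivAt (fun z : ι → ℝ => -∑ i, z i * (y i : ℝ))
          (-∑ i, (y i : ℝ) • ContinuousLinearMap.proj (R := ℝ) (φ := fun _ : ι => ℝ) i) z :=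
        (HasFDerivAt.fun_sum fun i _ => (hasFDerivAt_apply i z).mul_const (y i : ℝ)).neg
      refine h1.exp.congr_fderiv ?_
      ext v
      simp [F', Finset.mul_sum, mul_comm, mul_assoc]

theorem completelyMonotone [DecidableEq ι] (hf : IsLaplaceOnOrthant f) :
    CompletelyMonotoneOnOrthant f := by
  have hopen := isOpen_posOrthant ι
  have hsmooth : ∀ (k : ℕ) (f : (ι → ℝ) → ℝ), IsLaplaceOnOrthant f →
      ContDiffOn ℝ k f (posOrthant ι) := by
    intro k
    induction k with
    | zero =>
      intro f hf
      obtain ⟨g, -, hd⟩ := hf.exists_hasFDerivAt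
      exact contDiffOn_zero.2 fun x hx => (hd x hx).continuousAt.continuousWithinAt
    | succ k ih =>
      intro f hf
      obtain ⟨g, hg, hd⟩ := hf.exists_hasFDerivAt
      rw [Nat.cast_succ, contDiffOn_succ_iff_fderiv_of_isOpen hopen]
      refine ⟨fun x hx => (hd x hx).differentiableAt.differentiableWithinAt, by simp, ?_⟩
      refine ContDiffOn.congr ?_ fun x hx => (hd x hx).fderiv
      exact ContDiffOn.sum fun i _ => ((ih _ (hg i)).neg).smul contDiffOn_const
  refine ⟨contDiffOn_infty.2 fun k => hsmooth k f hf, fun k => ?_⟩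
  induction k generalizing f with
  | zero =>
    intro idx x hx
    obtain ⟨μ, -, H⟩ := hf
    simpa using (H x hx).1
  | succ k ih =>
    intro idx x hx
    obtain ⟨g, hg, hd⟩ := hf.exists_hasFDerivAt
    have hu := hopen.uniqueDiffOn (𝕜 := ℝ)
    rw [iteratedFDerivWithin_succ_apply_right hu hx]
    have hfd : ContDiffOn ℝ k (fderivWithin ℝ f (posOrthant ι)) (posOrthant ι) :=
      (hsmooth (k + 1) f hf).fderivWithin hu (by simp)
    have hcomp := (ContinuousLinearMap.apply ℝ ℝ
      (Pi.single (idx (Fin.last k)) (1 : ℝ) : ι → ℝ)).iteratedFDerivWithin_comp_left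
        (hfd x hx) hu hx le_rfl
    have hcongr : Set.EqOn ((ContinuousLinearMap.apply ℝ ℝ
        (Pi.single (idx (Fin.last k)) (1 : ℝ) : ι → ℝ)) ∘ fderivWithin ℝ f (posOrthant ι))
        (-(g (idx (Fin.last k)))) (posOrthant ι) := by
      intro z hz
      simp [((hd z hz).hasFDerivWithinAt).fderivWithin (hu z hz), Pi.single_apply]
    have h2 := iteratedFDerivWithin_congr (𝕜 := ℝ) hcongr hx k
    rw [hcomp, iteratedFDerivWithin_neg_apply hu hx] at h2
    have h3 := congrArg (fun L => L fun j : Fin k => (Pi.single (idx j.castSucc) (1 : ℝ) : ι → ℝ)) h2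
    have h4 := ih (hg (idx (Fin.last k))) (fun j => idx j.castSucc) x hx
    simp only [ContinuousLinearMap.compContinuousMultilinearMap_coe, Function.comp_apply,
      ContinuousLinearMap.apply_apply, neg_apply] at h3
    change 0 ≤ (-1 : ℝ) ^ (k + 1) * (iteratedFDerivWithin ℝ k
      (fun y => fderivWithin ℝ f (posOrthant ι) y) (posOrthant ι) x
        fun j : Fin k => (Pi.single (idx j.castSucc) (1 : ℝ) : ι → ℝ))
        (Pi.single (idx (Fin.last k)) (1 : ℝ))
    rw [h3, pow_succ]
    linarith

end IsLaplaceOnOrthant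

namespace Matrix

variable {κ : Type*} [Fintype κ]

lemma lintegral_exp_neg_dotProduct_self_ne_zero :
    ∫⁻ v : κ → ℝ, ENNReal.ofReal (Real.exp (-(v ⬝ᵥ v))) ≠ 0 := by
  rw [Ne, lintegral_eq_zero_iff (by simp only [dotProduct]; fun_prop)]
  intro h
  obtain ⟨v, hv⟩ := h.exists
  simp [(Real.exp_pos _).not_ge] at hv

lemma lintegral_exp_neg_dotProduct_self_ne_top :
    ∫⁻ v : κ → ℝ, ENNReal.ofReal (Real.exp (-(v ⬝ᵥ v))) ≠ ∞ := by
  have h : Integrable fun v : κ → ℝ => ∏ i, Real.exp (-1 * v i ^ 2) :=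
    Integrable.fintype_prod fun _ => integrable_exp_neg_mul_sq one_pos
  have h2 := h.2
  rw [hasFiniteIntegral_iff_ofReal
    (.of_forall fun v => Finset.prod_nonneg fun i _ => Real.exp_nonneg _)] at h2
  refine (lt_of_eq_of_lt ?_ h2).ne
  congr! 3 with v
  rw [← Real.exp_sum, dotProduct, ← Finset.sum_neg_distrib]
  congr! 2 with i
  ring

variable [DecidableEq κ]

open scoped MatrixOrder in
lemma PosDef.lintegral_exp_neg {D : Matrix κ κ ℝ} (hD : D.PosDef) :
    ∫⁻ u : κ → ℝ, ENNReal.ofReal (Real.exp (-(u ⬝ᵥ D *ᵥ u))) =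
      ENNReal.ofReal (D.det ^ (-(1 / 2) : ℝ)) *
        ∫⁻ v : κ → ℝ, ENNReal.ofReal (Real.exp (-(v ⬝ᵥ v))) := by
  obtain ⟨B, rfl⟩ : ∃ B, D = Bᴴ * B :=
    CStarAlgebra.nonneg_iff_eq_star_mul_self.1 (nonneg_iff_posSemidef.2 hD.posSemidef)
  have hdet : (Bᴴ * B).det = B.det ^ 2 := by simp [det_mul, sq]
  have hB : B.det ≠ 0 := fun h => hD.det_pos.ne' (by rw [hdet, h]; simp)
  have hpow : (Bᴴ * B).det ^ (-(1 / 2) : ℝ) = |B.det⁻¹| := by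
    rw [hdet, Real.rpow_neg (sq_nonneg _), ← Real.sqrt_eq_rpow, Real.sqrt_sq_eq_abs, abs_inv]
  have hmeas : Measurable fun v : κ → ℝ => ENNReal.ofReal (Real.exp (-(v ⬝ᵥ v))) := by
    simp only [dotProduct]; fun_prop
  rw [hpow, ← smul_eq_mul (ENNReal.ofReal _), ← lintegral_smul_measure,
    ← Real.map_matrix_volume_pi_eq_smul_volume_pi hB,
    lintegral_map hmeas (LinearMap.continuous_of_finiteDimensional _).measurable]
  congr! 4 with u
  rw [toLin'_apply, conjTranspose_eq_transpose_of_trivial, ← mulVec_mulVec, dotProduct_mulVec,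
    vecMul_transpose]

lemma PosDef.det_toBlocks₂₂_pos {M : Matrix (Unit ⊕ κ) (Unit ⊕ κ) ℝ} (hM : M.PosDef) :
    0 < M.toBlocks₂₂.det :=
  (hM.submatrix Sum.inr_injective).det_pos

lemma PosDef.dotProduct_mulVec_sumElim {M : Matrix (Unit ⊕ κ) (Unit ⊕ κ) ℝ} (hM : M.PosDef)
    (r : ℝ) (u : κ → ℝ) :
    Sum.elim (fun _ : Unit => r) u ⬝ᵥ M *ᵥ Sum.elim (fun _ : Unit => r) u =
      (u + (M.toBlocks₂₂⁻¹ * M.toBlocks₂₁) *ᵥ fun _ => r) ⬝ᵥ M.toBlocks₂₂ *ᵥ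
        (u + (M.toBlocks₂₂⁻¹ * M.toBlocks₂₁) *ᵥ fun _ => r) +
      r ^ 2 * (M.det / M.toBlocks₂₂.det) := by
  have hD : M.toBlocks₂₂.PosDef := hM.submatrix Sum.inr_injective
  have : Invertible M.toBlocks₂₂ := hD.isUnit.invertible
  have h21 : M.toBlocks₂₁ = M.toBlocks₁₂ᴴ := by
    ext i j
    exact (hM.isHermitian.apply (Sum.inr i) (Sum.inl j)).symm
  have hblocks := fromBlocks_toBlocks M
  have hs : M.det / M.toBlocks₂₂.det =
      (M.toBlocks₁₁ - M.toBlocks₁₂ * M.toBlocks₂₂⁻¹ * M.toBlocks₁₂ᴴ) () () := by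
    rw [div_eq_iff hD.det_pos.ne']
    conv_lhs => rw [← hblocks, det_fromBlocks₂₂, h21, invOf_eq_nonsing_inv,
      det_unique (n := Unit)]
    exact mul_comm _ _
  have key := schur_complement_eq₂₂ M.toBlocks₁₁ M.toBlocks₁₂ (fun _ => r) u hD.isHermitian
  rw [← h21, hblocks] at key
  simp only [star_trivial, ← dotProduct_mulVec] at key
  rw [key, hs, add_comm u, ← h21]
  congr 1
  simp [dotProduct, mulVec]
  ring

lemma PosDef.lintegral_sumElim {M : Matrix (Unit ⊕ κ) (Unit ⊕ κ) ℝ} (hM : M.PosDef) (r : ℝ) :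
    ∫⁻ u : κ → ℝ, ENNReal.ofReal (Real.exp
        (-(Sum.elim (fun _ : Unit => r) u ⬝ᵥ M *ᵥ Sum.elim (fun _ : Unit => r) u))) =
      ENNReal.ofReal (Real.exp (-(r ^ 2 * (M.det / M.toBlocks₂₂.det)))) *
        (ENNReal.ofReal (M.toBlocks₂₂.det ^ (-(1 / 2) : ℝ)) *
          ∫⁻ v : κ → ℝ, ENNReal.ofReal (Real.exp (-(v ⬝ᵥ v)))) := by
  have hD : M.toBlocks₂₂.PosDef := hM.submatrix Sum.inr_injective
  simp_rw [hM.dotProduct_mulVec_sumElim, neg_add, Real.exp_add,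
    ENNReal.ofReal_mul (Real.exp_nonneg _)]
  rw [lintegral_mul_const' _ _ ENNReal.ofReal_ne_top, mul_comm, ← hD.lintegral_exp_neg]
  congr 1
  exact lintegral_add_right_eq_self
    (fun u => ENNReal.ofReal (Real.exp (-(u ⬝ᵥ M.toBlocks₂₂ *ᵥ u)))) _

end Matrix

lemma lintegral_rpow_mul_exp_neg_mul {β s : ℝ} (hβ : 0 < β) (hs : 0 < s) :
    ∫⁻ t in Set.Ioi (0 : ℝ), ENNReal.ofReal (t ^ (β - 1)) * ENNReal.ofReal (Real.exp (-(t * s))) =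
      ENNReal.ofReal (Real.Gamma β) * ENNReal.ofReal (s ^ (-β)) := by
  have h := Real.integral_rpow_mul_exp_neg_mul_Ioi hβ hs
  have hpos : 0 < (1 / s) ^ β * Real.Gamma β :=
    mul_pos (Real.rpow_pos_of_pos (by positivity) _) (Real.Gamma_pos_of_pos hβ)
  have hint : IntegrableOn (fun t : ℝ => t ^ (β - 1) * Real.exp (-(s * t))) (Set.Ioi 0) :=
    not_imp_comm.1 integral_undef (h ▸ hpos.ne')
  have hnonneg : ∀ᵐ t ∂volume.restrict (Set.Ioi (0 : ℝ)),
      0 ≤ t ^ (β - 1) * Real.exp (-(s * t)) :=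
    (ae_restrict_iff' measurableSet_Ioi).2 (.of_forall fun t ht =>
      mul_nonneg (Real.rpow_nonneg (le_of_lt ht) _) (Real.exp_nonneg _))
  rw [← ENNReal.ofReal_mul (Real.Gamma_pos_of_pos hβ).le, Real.rpow_neg hs.le,
    ← Real.inv_rpow hs.le, inv_eq_one_div, mul_comm (Real.Gamma β), ← h,
    ofReal_integral_eq_lintegral_ofReal hint hnonneg]
  refine setLIntegral_congr_fun measurableSet_Ioi fun t ht => ?_
  simp only [mul_comm s t]
  rw [ENNReal.ofReal_mul (Real.rpow_nonneg (le_of_lt ht) _)]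

namespace IsLaplaceOnOrthant

open Matrix

variable {ι : Type*} [Fintype ι]

lemma det_div_det_rpow {κ : Type*} [Fintype κ] [DecidableEq κ]
    {A : ι → Matrix (Unit ⊕ κ) (Unit ⊕ κ) ℝ}
    (hpsd : ∀ i, (A i).PosSemidef) (hpd : ∀ x ∈ posOrthant ι, (∑ i, x i • A i).PosDef)
    {β : ℝ} (hβ : 0 < β) :
    IsLaplaceOnOrthant fun x : ι → ℝ =>
      ((∑ i, x i • A i).det / (∑ i, x i • A i).toBlocks₂₂.det) ^ (-β) *
        (∑ i, x i • A i).toBlocks₂₂.det ^ (-(1 / 2) : ℝ) := by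
  have hw : Measurable fun p : ℝ × (κ → ℝ) => Sum.elim (fun _ : Unit => √p.1) p.2 := by
    refine measurable_pi_iff.2 fun i => ?_
    cases i <;> simp <;> fun_prop
  have hq : ∀ M : Matrix (Unit ⊕ κ) (Unit ⊕ κ) ℝ,
      Measurable fun w : Unit ⊕ κ → ℝ => w ⬝ᵥ M *ᵥ w := by
    intro M
    simp only [dotProduct, mulVec]
    fun_prop
  refine of_lintegral
    (((volume.restrict (Set.Ioi (0 : ℝ))).withDensity fun t => ENNReal.ofReal (t ^ (β - 1))).prod
      (volume : Measure (κ → ℝ)))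
    (fun p i => Sum.elim (fun _ : Unit => √p.1) p.2 ⬝ᵥ A i *ᵥ Sum.elim (fun _ : Unit => √p.1) p.2)
    (measurable_pi_iff.2 fun i => (hq (A i)).comp hw)
    (fun p i => (hpsd i).dotProduct_mulVec_nonneg _)
    (ENNReal.ofReal (Real.Gamma β) * ∫⁻ v : κ → ℝ, ENNReal.ofReal (Real.exp (-(v ⬝ᵥ v))))
    (mul_ne_zero (by simpa using Real.Gamma_pos_of_pos hβ)
      lintegral_exp_neg_dotProduct_self_ne_zero)
    (ENNReal.mul_ne_top ENNReal.ofReal_ne_top lintegral_exp_neg_dotProduct_self_ne_top)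
    fun x hx => ?_
  have hM := hpd x hx
  have hsum : ∀ w : Unit ⊕ κ → ℝ, ∑ i, x i * (w ⬝ᵥ A i *ᵥ w) = w ⬝ᵥ (∑ i, x i • A i) *ᵥ w := by
    intro w
    simp [sum_mulVec, dotProduct_sum, smul_mulVec]
  simp only [hsum]
  generalize ∑ i, x i • A i = M at hM
  have hd := hM.det_toBlocks₂₂_pos
  have hs : 0 < M.det / M.toBlocks₂₂.det := div_pos hM.det_pos hd
  have h1 : 0 ≤ (M.det / M.toBlocks₂₂.det) ^ (-β) := Real.rpow_nonneg hs.le _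
  refine ⟨mul_nonneg h1 (Real.rpow_nonneg hd.le _), ?_⟩
  have hmeas : Measurable fun p : ℝ × (κ → ℝ) => ENNReal.ofReal (Real.exp
      (-(Sum.elim (fun _ : Unit => √p.1) p.2 ⬝ᵥ M *ᵥ Sum.elim (fun _ : Unit => √p.1) p.2))) :=
    ((hq M).comp hw).neg.exp.ennreal_ofReal
  rw [lintegral_prod _ hmeas.aemeasurable]
  simp only [hM.lintegral_sumElim]
  rw [lintegral_withDensity_eq_lintegral_mul _ (by fun_prop) (by fun_prop)]
  simp only [Pi.mul_apply, ← mul_assoc]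
  have hK := lintegral_exp_neg_dotProduct_self_ne_top (κ := κ)
  rw [lintegral_mul_const' _ _ hK, lintegral_mul_const' _ _ ENNReal.ofReal_ne_top,
    ENNReal.ofReal_mul h1]
  have h2 := lintegral_rpow_mul_exp_neg_mul hβ hs
  rw [setLIntegral_congr_fun measurableSet_Ioi fun t ht => by
    rw [Real.sq_sqrt (le_of_lt ht)], h2]
  ring

lemma det_rpow_neg_half {m : ℕ} {A : ι → Matrix (Fin m) (Fin m) ℝ}
    (hpsd : ∀ i, (A i).PosSemidef) (hpd : ∀ x ∈ posOrthant ι, (∑ i, x i • A i).PosDef) :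
    IsLaplaceOnOrthant fun x : ι → ℝ => (∑ i, x i • A i).det ^ (-(1 / 2) : ℝ) := by
  cases m with
  | zero => simpa using one
  | succ m =>
    let e : Unit ⊕ Fin m ≃ Fin (m + 1) := Fintype.equivOfCardEq (by simp [add_comm])
    have hsum : ∀ x : ι → ℝ,
        ∑ i, x i • (A i).submatrix e e = (∑ i, x i • A i).submatrix e e := by
      intro x; ext; simp [Matrix.sum_apply]
    have hpd' : ∀ x ∈ posOrthant ι, (∑ i, x i • (A i).submatrix e e).PosDef := fun x hx =>
      hsum x ▸ (hpd x hx).submatrix e.injective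
    refine (det_div_det_rpow (fun i => (hpsd i).submatrix e) hpd' one_half_pos).congr
      fun x hx => ?_
    have hM := hpd' x hx
    have hd := hM.det_toBlocks₂₂_pos
    rw [← Real.mul_rpow (div_pos hM.det_pos hd).le hd.le, div_mul_cancel₀ _ hd.ne', hsum,
      det_submatrix_equiv_self]

lemma det_rpow_neg {m : ℕ} {A : ι → Matrix (Fin m) (Fin m) ℝ}
    (hpsd : ∀ i, (A i).PosSemidef) (hpd : ∀ x ∈ posOrthant ι, (∑ i, x i • A i).PosDef)
    {β : ℝ} (hβ : ((m : ℝ) - 1) / 2 ≤ β) :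
    IsLaplaceOnOrthant fun x : ι → ℝ => (∑ i, x i • A i).det ^ (-β) := by
  induction m generalizing β with
  | zero => simpa using one
  | succ m ih =>
    push_cast at hβ
    have hm : (0 : ℝ) ≤ m := m.cast_nonneg
    rcases (show 0 ≤ β by linarith).eq_or_lt with rfl | hβ0
    · simpa using one
    let e : Unit ⊕ Fin m ≃ Fin (m + 1) := Fintype.equivOfCardEq (by simp [add_comm])
    have hsum : ∀ x : ι → ℝ,
        ∑ i, x i • (A i).submatrix e e = (∑ i, x i • A i).submatrix e e := by
      intro x; ext; simp [Matrix.sum_apply]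
    have hpd' : ∀ x ∈ posOrthant ι, (∑ i, x i • (A i).submatrix e e).PosDef := fun x hx =>
      hsum x ▸ (hpd x hx).submatrix e.injective
    have hsum' : ∀ x : ι → ℝ, ∑ i, x i • ((A i).submatrix e e).toBlocks₂₂ =
        (∑ i, x i • (A i).submatrix e e).toBlocks₂₂ := by
      intro x; ext; simp [Matrix.sum_apply, toBlocks₂₂]
    have hlower := ih (A := fun i => ((A i).submatrix e e).toBlocks₂₂) (β := β - 1 / 2)
      (fun i => ((hpsd i).submatrix e).submatrix Sum.inr)
      (fun x hx => hsum' x ▸ (hpd' x hx).submatrix Sum.inr_injective) (by linarith)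
    refine ((det_div_det_rpow (fun i => (hpsd i).submatrix e) hpd' hβ0).mul hlower).congr
      fun x hx => ?_
    have hM := hpd' x hx
    have hd := hM.det_toBlocks₂₂_pos
    simp only [hsum']
    rw [mul_assoc, ← Real.rpow_add hd, show -(1 / 2) + -(β - 1 / 2) = -β by ring,
      ← Real.mul_rpow (div_pos hM.det_pos hd).le hd.le, div_mul_cancel₀ _ hd.ne', hsum,
      det_submatrix_equiv_self]

end IsLaplaceOnOrthant

open scoped Matrix in
lemma posDef_sum_smul_of_rank_eq {ι : Type*} [Fintype ι] {m : ℕ}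
    {A : ι → Matrix (Fin m) (Fin m) ℝ} (hpsd : ∀ i, (A i).PosSemidef)
    (hrank : ∃ c : ι → ℝ, (∑ i, c i • A i).rank = m) {x : ι → ℝ} (hx : x ∈ posOrthant ι) :
    (∑ i, x i • A i).PosDef := by
  obtain ⟨c, hc⟩ := hrank
  have hterm : ∀ i, (x i • A i).PosSemidef := fun i => (hpsd i).smul (hx i).le
  refine Matrix.PosDef.of_dotProduct_mulVec_pos
    (Matrix.posSemidef_sum _ fun i _ => hterm i).isHermitian fun v hv => ?_
  by_contra! hle
  refine hv ?_
  have hnn : ∀ i ∈ Finset.univ, 0 ≤ star v ⬝ᵥ (x i • A i) *ᵥ v := fun i _ =>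
    (hterm i).dotProduct_mulVec_nonneg v
  rw [Matrix.sum_mulVec, dotProduct_sum] at hle
  have hzero := (Finset.sum_eq_zero_iff_of_nonneg hnn).1 (hle.antisymm (Finset.sum_nonneg hnn))
  have hAv : ∀ i, A i *ᵥ v = 0 := fun i => by
    have := ((hterm i).dotProduct_mulVec_zero_iff v).1 (hzero i (Finset.mem_univ i))
    rwa [Matrix.smul_mulVec, smul_eq_zero_iff_right (hx i).ne'] at this
  have hcv : (∑ i, c i • A i) *ᵥ v = 0 := by
    simp [Matrix.sum_mulVec, Matrix.smul_mulVec, hAv]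
  have hinj : Function.Injective (∑ i, c i • A i).mulVec := by
    rw [Matrix.mulVec_injective_iff, linearIndependent_iff_card_eq_finrank_span,
      Set.finrank, ← Matrix.rank_eq_finrank_span_cols, hc, Fintype.card_fin]
  exact hinj (hcv.trans (Matrix.mulVec_zero _).symm)

/-- Let `A_1, …, A_n` (`n ≥ 1`) be real symmetric positive-semidefinite
`m×m` matrices such that some real linear combination of them has rank `m`, and let
`P(x) = det (∑ i, x_i A_i)`.  Then `P > 0` on `(0,∞)^n`, and `P^{-β}` is completely
monotone on `(0,∞)^n` for every `β ∈ {0, 1/2, 1, 3/2, …}` and every real `β ≥ (m−1)/2`. -/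
theorem inverse_power_det_real_symmetric_completely_monotone
    {n m : ℕ} (hn : 1 ≤ n) (A : Fin n → Matrix (Fin m) (Fin m) ℝ)
    (hsymm : ∀ i, (A i).IsSymm) (hpsd : ∀ i, (A i).PosSemidef)
    (hrank : ∃ c : Fin n → ℝ, (∑ i, c i • A i).rank = m)
    (β : ℝ) (hβ : (∃ k : ℕ, β = (k : ℝ) / 2) ∨ ((m : ℝ) - 1) / 2 ≤ β) :
    (∀ x ∈ posOrthant (Fin n), 0 < (∑ i, x i • A i).det) ∧
      CompletelyMonotoneOnOrthant
        (fun x : Fin n → ℝ => (∑ i, x i • A i).det ^ (-β)) := by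
  have hpd : ∀ x ∈ posOrthant (Fin n), (∑ i, x i • A i).PosDef := fun x hx =>
    posDef_sum_smul_of_rank_eq hpsd hrank hx
  refine ⟨fun x hx => (hpd x hx).det_pos, IsLaplaceOnOrthant.completelyMonotone ?_⟩
  rcases hβ with ⟨k, rfl⟩ | hβ
  · refine ((IsLaplaceOnOrthant.det_rpow_neg_half hpsd hpd).pow k).congr fun x hx => ?_
    rw [← Real.rpow_mul_natCast (hpd x hx).det_pos.le]
    congr 1
    ring
  · exact IsLaplaceOnOrthant.det_rpow_neg hpsd hpd hβ
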